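/- Let G be a non-elementary hyperbolic group. The metric space (𝒟(G), Δ) is contractible, where Δ([d1],[d2]) = log Λ([d1],[d2]). -/

import Mathlib

open Filter Set MeasureTheory Topology

noncomputable section

variable {X : Type*}

/-- The Gromov product `(x|y)_w` with respect to `d`. -/
def gp (d : X → X → ℝ) (w x y : X) : ℝ := (d x w + d y w - d x y) / 2

/-- `d` is a pseudometric. -/
def IsPseudometric (d : X → X → ℝ) : Prop :=
  (∀ x, d x x = 0) ∧ (∀ x y, d x y = d y x) ∧ (∀ x y z, d x z ≤ d x y + d y z)

/-- `d` is `δ`-hyperbolic: the four-point Gromov product condition. -/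
def GromovHyperbolic (d : X → X → ℝ) (δ : ℝ) : Prop :=
  ∀ x y z w, min (gp d w x y) (gp d w y z) - δ ≤ gp d w x z

/-- `d` is `α`-rough geodesic: any two points are joined by an `α`-rough geodesic. -/
def RoughGeodesic (d : X → X → ℝ) (α : ℝ) : Prop :=
  ∀ x y : X, ∃ (n : ℕ) (γ : ℕ → X), γ 0 = x ∧ γ n = y ∧
    ∀ i j : ℕ, i ≤ n → j ≤ n →
      |(i : ℝ) - (j : ℝ)| - α ≤ d (γ i) (γ j) ∧ d (γ i) (γ j) ≤ |(i : ℝ) - (j : ℝ)| + α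

variable {G : Type*} [Group G]

/-- Left invariance of a pseudometric on a group. -/
def LeftInvariant (d : G → G → ℝ) : Prop := ∀ g x y : G, d (g * x) (g * y) = d x y

/-- Word norm with respect to a subset `S`. -/
def wordNorm (S : Set G) (w : G) : ℕ :=
  sInf {k : ℕ | ∃ f : Fin k → G, (∀ i, f i ∈ S) ∧ (List.ofFn f).prod = w}

/-- Word metric with respect to a subset `S`. -/
def wordDist (S : Set G) (x y : G) : ℝ := (wordNorm S (x⁻¹ * y) : ℝ)

/-- `S` is a symmetric generating set. -/
def GenSymm (S : Set G) : Prop := (∀ s ∈ S, s⁻¹ ∈ S) ∧ Subgroup.closure S = ⊤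

/-- `d'` is quasi-isometric to `d` (via the identity map of `G`). -/
def QIsometric (d d' : G → G → ℝ) : Prop :=
  ∃ l1 l2 e : ℝ, 0 < l1 ∧ 0 < l2 ∧ 0 ≤ e ∧
    ∀ x y : G, d x y / l1 - e ≤ d' x y ∧ d' x y ≤ l2 * d x y + e

/-- Membership in `D(G)`: a left-invariant hyperbolic pseudometric on `G`
quasi-isometric to a word metric w.r.t. a finite symmetric generating set. -/
def InD (d : G → G → ℝ) : Prop :=
  IsPseudometric d ∧ LeftInvariant d ∧ (∃ δ ≥ (0 : ℝ), GromovHyperbolic d δ) ∧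
    ∃ S : Finset G, GenSymm (S : Set G) ∧ QIsometric (wordDist (S : Set G)) d

/-- `G` is a hyperbolic group: some word metric is Gromov hyperbolic. -/
def IsHyperbolicGroup (G : Type*) [Group G] : Prop :=
  ∃ S : Finset G, GenSymm (S : Set G) ∧ ∃ δ ≥ (0 : ℝ), GromovHyperbolic (wordDist (S : Set G)) δ

/-- `G` is non-elementary: it is not virtually abelian. -/
def NonElementary (G : Type*) [Group G] : Prop :=
  ¬ ∃ H : Subgroup G, H.FiniteIndex ∧ ∀ a ∈ H, ∀ b ∈ H, a * b = b * a

/-- Translation length `ℓ_d(x) = lim_n d(x^n,1)/n`; by Fekete's subadditivity lemma the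
limit exists and equals the infimum of `d(x^n,1)/n` over `n ≥ 1`. -/
def tlen (d : G → G → ℝ) (x : G) : ℝ :=
  sInf {r : ℝ | ∃ n : ℕ, r = d (x ^ (n + 1)) 1 / (n + 1)}

/-- Dilation `Dil(d,d') = sup_x ℓ_d(x)/ℓ_{d'}(x)` over infinite-order elements. -/
def Dil (d d' : G → G → ℝ) : ℝ :=
  sSup {r : ℝ | ∃ x : G, ¬ IsOfFinOrder x ∧ r = tlen d x / tlen d' x}

/-- Critical exponent `h(d) = lim_n log|B_d(n)|/n` (the limit exists, so it equals
the limsup used here). -/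
def hCrit (d : G → G → ℝ) : ℝ :=
  Filter.limsup (fun n : ℕ => Real.log (Set.ncard {x : G | d x 1 ≤ (n : ℝ)}) / (n : ℝ)) atTop

/-- `Λ(d1,d2)`: the infimum of `λ1·λ2` over quasi-isometry constants between `d1,d2`. -/
def Lam (d1 d2 : G → G → ℝ) : ℝ :=
  sInf {l : ℝ | ∃ l1 l2 A : ℝ, 0 < l1 ∧ 0 < l2 ∧ 0 ≤ A ∧ l = l1 * l2 ∧
    ∀ x y : G, d2 x y / l1 - A ≤ d1 x y ∧ d1 x y ≤ l2 * d2 x y + A}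

/-- Rough similarity of pseudometrics: `|d − k·d'| ≤ A` for some `k > 0`, `A ≥ 0`. -/
def RSim (d d' : G → G → ℝ) : Prop :=
  ∃ k A : ℝ, 0 < k ∧ 0 ≤ A ∧ ∀ x y : G, |d x y - k * d' x y| ≤ A

set_option linter.unusedSectionVars false in
theorem rsim_refl (d : G → G → ℝ) : RSim d d :=
  ⟨1, 0, one_pos, le_refl 0, fun x y => by simp⟩

set_option linter.unusedSectionVars false in
theorem rsim_symm {d d' : G → G → ℝ} : RSim d d' → RSim d' d := by
  rintro ⟨k, A, hk, hA, h⟩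
  refine ⟨k⁻¹, k⁻¹ * A, inv_pos.2 hk, mul_nonneg (inv_pos.2 hk).le hA, fun x y => ?_⟩
  have hk0 : k ≠ 0 := ne_of_gt hk
  have h1 : d' x y - k⁻¹ * d x y = -(k⁻¹ * (d x y - k * d' x y)) := by
    field_simp
    ring
  rw [h1, abs_neg, abs_mul, abs_of_pos (inv_pos.2 hk)]
  exact mul_le_mul_of_nonneg_left (h x y) (inv_pos.2 hk).le

set_option linter.unusedSectionVars false in
theorem rsim_trans {d1 d2 d3 : G → G → ℝ} : RSim d1 d2 → RSim d2 d3 → RSim d1 d3 := by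
  rintro ⟨k1, A1, hk1, hA1, h1⟩ ⟨k2, A2, hk2, hA2, h2⟩
  refine ⟨k1 * k2, A1 + k1 * A2, mul_pos hk1 hk2, by positivity, fun x y => ?_⟩
  have h3 : |k1 * d2 x y - k1 * k2 * d3 x y| = k1 * |d2 x y - k2 * d3 x y| := by
    rw [show k1 * d2 x y - k1 * k2 * d3 x y = k1 * (d2 x y - k2 * d3 x y) by ring,
      abs_mul, abs_of_pos hk1]
  calc |d1 x y - k1 * k2 * d3 x y|
      ≤ |d1 x y - k1 * d2 x y| + |k1 * d2 x y - k1 * k2 * d3 x y| :=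
        abs_sub_le _ _ _
    _ ≤ A1 + k1 * A2 := by
        rw [h3]
        exact add_le_add (h1 x y) (mul_le_mul_of_nonneg_left (h2 x y) hk1.le)

/-- Elements of `D(G)`. -/
def DSub (G : Type*) [Group G] : Type _ := {d : G → G → ℝ // InD d}

/-- Rough similarity as a setoid on `D(G)`. -/
def rsSetoid (G : Type*) [Group G] : Setoid (DSub G) :=
  ⟨fun d d' => RSim d.1 d'.1,
    ⟨fun d => rsim_refl d.1, fun h => rsim_symm h, fun h h' => rsim_trans h h'⟩⟩

/-- The space `𝒟(G)` of metric structures on `G`. -/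
def MetricStructures (G : Type*) [Group G] : Type _ := Quotient (rsSetoid G)

/-- The distance `Δ = log Λ` on `𝒟(G)` (the value of `Λ` does not depend on the
choice of representatives). -/
def Delta (ρ1 ρ2 : MetricStructures G) : ℝ :=
  Real.log (sInf {l : ℝ | ∃ d1 d2 : DSub G,
    Quotient.mk (rsSetoid G) d1 = ρ1 ∧ Quotient.mk (rsSetoid G) d2 = ρ2 ∧ l = Lam d1.1 d2.1})

/-! ### Coarse four point condition and the Morse lemma -/

/-- Four point condition, in the form with three sums. -/
def FourPt (d : X → X → ℝ) (K : ℝ) : Prop :=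
  ∀ x y z w, d x y + d z w ≤ max (d x z + d y w) (d x w + d y z) + K

theorem fourPt_of_hyp {d : X → X → ℝ} {δ : ℝ} (hp : IsPseudometric d)
    (h : GromovHyperbolic d δ) : FourPt d (2 * δ) := by
  obtain ⟨-, hs, -⟩ := hp
  intro x y z w
  have := h x z y w
  unfold gp at this
  rw [hs z y] at this
  rcases le_total (d x z + d y w) (d x w + d y z) with h1 | h1
  · rw [max_eq_right h1]
    rcases min_choice ((d x w + d z w - d x z) / 2) ((d z w + d y w - d y z) / 2) with h2 | h2
    · rw [h2] at this; linarith
    · rw [h2] at this; linarith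
  · rw [max_eq_left h1]
    rcases min_choice ((d x w + d z w - d x z) / 2) ((d z w + d y w - d y z) / 2) with h2 | h2
    · rw [h2] at this; linarith
    · rw [h2] at this; linarith

theorem hyp_of_fourPt {d : X → X → ℝ} {K : ℝ} (hp : IsPseudometric d)
    (h : FourPt d K) : GromovHyperbolic d (K / 2) := by
  obtain ⟨-, hs, -⟩ := hp
  intro x y z w
  have := h x z y w
  unfold gp
  rw [hs z y] at this
  rcases max_choice (d x y + d z w) (d x w + d y z) with h2 | h2
  · rw [h2] at this
    have := min_le_left ((d x w + d y w - d x y) / 2) ((d y w + d z w - d y z) / 2)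
    linarith
  · rw [h2] at this
    have := min_le_right ((d x w + d y w - d x y) / 2) ((d y w + d z w - d y z) / 2)
    linarith

theorem pm_nonneg {d : X → X → ℝ} (hp : IsPseudometric d) (x y : X) : 0 ≤ d x y := by
  obtain ⟨h0, hs, ht⟩ := hp
  have := ht x y x
  rw [h0, hs y x] at this
  linarith

theorem fourPt_nonneg {d : X → X → ℝ} {K : ℝ} (hp : IsPseudometric d) (h : FourPt d K)
    (x : X) : 0 ≤ K := by
  have := h x x x x
  simp [hp.1] at this
  exact this

/-- Logarithmic chain inequality. -/
theorem chain_log (g : ℕ → ℕ → ℝ) (K M : ℝ) (hK : 0 ≤ K)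
    (hg : ∀ i j k, min (g i j) (g j k) - K ≤ g i k) (n : ℕ)
    (h1 : ∀ i, i ≤ n → M ≤ g i i) (h2 : ∀ i, i + 1 ≤ n → M ≤ g i (i + 1)) (r : ℕ) :
    ∀ i j, i ≤ j → j ≤ n → j ≤ i + 2 ^ r → M - K * r ≤ g i j := by
  induction r with
  | zero =>
    intro i j hij hj hr
    have : j = i ∨ j = i + 1 := by simp at hr; omega
    rcases this with rfl | rfl
    · simpa using h1 _ hj
    · simpa using h2 _ hj
  | succ r ih =>
    intro i j hij hj hr
    push_cast
    by_cases hc : j ≤ i + 2 ^ r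
    · have := ih i j hij hj hc
      linarith
    · have e1 := ih i (i + 2 ^ r) (by omega) (by omega) le_rfl
      have e2 := ih (i + 2 ^ r) j (by omega) hj (by rw [pow_succ] at hr; omega)
      have := hg i (i + 2 ^ r) j
      have := le_min e1 e2
      linarith

/-- Distance to the virtual point at parameter `s` on a segment from `x` to `y`. -/
def vdist (d : X → X → ℝ) (x y : X) (s : ℝ) (z : X) : ℝ :=
  max (d x z - s) (d y z - (d x y - s))

theorem vdist_pair {d : X → X → ℝ} {K : ℝ} (h : FourPt d K)
    (x y : X) (s : ℝ) (z w : X) : d z w ≤ vdist d x y s z + vdist d x y s w + K := by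
  have h1 := h x y z w
  have a1 := le_max_left (d x z - s) (d y z - (d x y - s))
  have a2 := le_max_right (d x z - s) (d y z - (d x y - s))
  have b1 := le_max_left (d x w - s) (d y w - (d x y - s))
  have b2 := le_max_right (d x w - s) (d y w - (d x y - s))
  unfold vdist
  rcases max_choice (d x z + d y w) (d x w + d y z) with h2 | h2 <;> rw [h2] at h1 <;> linarith

theorem vdist_lip {d : X → X → ℝ} (hp : IsPseudometric d)
    (x y : X) (s : ℝ) (z w : X) : vdist d x y s z ≤ vdist d x y s w + d w z := by
  have a := hp.2.2 x w z
  have b := hp.2.2 y w z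
  have b1 := le_max_left (d x w - s) (d y w - (d x y - s))
  have b2 := le_max_right (d x w - s) (d y w - (d x y - s))
  unfold vdist
  apply max_le <;> linarith

theorem vdist_param {d : X → X → ℝ} (x y : X) (s s' : ℝ) (z : X) :
    vdist d x y s z ≤ vdist d x y s' z + |s - s'| := by
  have b1 := le_max_left (d x z - s') (d y z - (d x y - s'))
  have b2 := le_max_right (d x z - s') (d y z - (d x y - s'))
  have := neg_abs_le (s - s')
  have := le_abs_self (s - s')
  unfold vdist
  apply max_le <;> linarith

theorem vdist_hyp {d : X → X → ℝ} {K : ℝ} (hp : IsPseudometric d) (h : FourPt d K)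
    (x y : X) (s : ℝ) (z u w : X) :
    min (vdist d x y s z + vdist d x y s u - d z u) (vdist d x y s u + vdist d x y s w - d u w) - K
      ≤ vdist d x y s z + vdist d x y s w - d z w := by
  have key : ∀ p, d p u + d z w ≤ max (d p w + d z u) (d p z + d u w) + K := by
    intro p
    have := h p u z w
    rw [max_comm] at this
    rwa [hp.2.1 u z] at this
  have z1 := le_max_left (d x z - s) (d y z - (d x y - s))
  have z2 := le_max_right (d x z - s) (d y z - (d x y - s))
  have w1 := le_max_left (d x w - s) (d y w - (d x y - s))
  have w2 := le_max_right (d x w - s) (d y w - (d x y - s))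
  have m1 := min_le_left (vdist d x y s z + vdist d x y s u - d z u)
    (vdist d x y s u + vdist d x y s w - d u w)
  have m2 := min_le_right (vdist d x y s z + vdist d x y s u - d z u)
    (vdist d x y s u + vdist d x y s w - d u w)
  unfold vdist at *
  rcases max_choice (d x u - s) (d y u - (d x y - s)) with hu | hu
  · have := key x
    rcases max_choice (d x w + d z u) (d x z + d u w) with h2 | h2 <;> rw [h2] at this <;> linarith
  · have := key y
    rcases max_choice (d y w + d z u) (d y z + d u w) with h2 | h2 <;> rw [h2] at this <;> linarith

theorem vdist_left {d : X → X → ℝ} (hp : IsPseudometric d) (x y : X) (s : ℝ) (hs : 0 ≤ s) :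
    vdist d x y s x = s := by
  unfold vdist
  rw [hp.1, hp.2.1 y x, max_eq_right] <;> linarith

theorem vdist_right {d : X → X → ℝ} (hp : IsPseudometric d) (x y : X) (s : ℝ)
    (hs : s ≤ d x y) : vdist d x y s y = d x y - s := by
  unfold vdist
  rw [hp.1, max_eq_left]; linarith

theorem exp_beats_linear (a b : ℝ) : ∃ r0 : ℕ, ∀ r : ℕ, r0 ≤ r → a * r + b ≤ 2 ^ r := by
  have h1 : Tendsto (fun r : ℕ => a * ((r : ℝ) ^ 1 / 2 ^ r) + b * ((r : ℝ) ^ 0 / 2 ^ r))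
      atTop (𝓝 (a * 0 + b * 0)) :=
    ((tendsto_pow_const_div_const_pow_of_one_lt 1 one_lt_two).const_mul a).add
      ((tendsto_pow_const_div_const_pow_of_one_lt 0 one_lt_two).const_mul b)
  have h2 := h1.eventually (gt_mem_nhds (show a * 0 + b * 0 < (1 : ℝ) by simp))
  obtain ⟨r0, hr⟩ := eventually_atTop.1 h2
  refine ⟨r0, fun r h => ?_⟩
  have h3 := hr r h
  have h4 : (0 : ℝ) < 2 ^ r := by positivity
  have h5 : a * ((r : ℝ) ^ 1 / 2 ^ r) + b * ((r : ℝ) ^ 0 / 2 ^ r) = (a * r + b) / 2 ^ r := by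
    field_simp
  rw [h5, div_lt_one h4] at h3
  exact h3.le

theorem exists_D0 (K L e : ℝ) (hK : 0 ≤ K) (hL : 0 ≤ L) :
    ∃ D0 : ℕ, ∀ D : ℕ, D0 ≤ D → ∃ r : ℕ, L * (6 * D + K) + e ≤ 2 ^ r ∧
      K < 2 * ((D : ℝ) - 1) - L - K * r := by
  obtain ⟨c, hc⟩ := exists_nat_ge (K + 1)
  have hc0 : 0 < c := by
    have : (0 : ℝ) < c := by linarith
    exact_mod_cast this
  obtain ⟨r0, hr0⟩ := exp_beats_linear (6 * L * c) (6 * L * c + L * K + e)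
  obtain ⟨N, hN⟩ := exists_nat_gt (K + L + 2)
  refine ⟨max (c * r0) N, fun D hD => ⟨D / c, ?_, ?_⟩⟩
  · have h1 : r0 ≤ D / c := by
      rw [Nat.le_div_iff_mul_le hc0, mul_comm]
      exact (le_max_left _ _).trans hD
    have h2 := hr0 _ h1
    have h3 : D ≤ c * (D / c + 1) := by
      have := Nat.div_add_mod D c
      have := Nat.mod_lt D hc0
      rw [mul_add]; omega
    have h4 : (D : ℝ) ≤ c * ((D / c : ℕ) + 1) := by exact_mod_cast h3
    have h5 := mul_le_mul_of_nonneg_left h4 hL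
    refine le_trans ?_ h2
    nlinarith
  · have h3 : c * (D / c) ≤ D := Nat.mul_div_le D c
    have h4 : (c : ℝ) * (D / c : ℕ) ≤ D := by exact_mod_cast h3
    have h5 : (N : ℝ) ≤ D := by exact_mod_cast (le_max_right _ _).trans hD
    have h6 : (0 : ℝ) ≤ (D / c : ℕ) := Nat.cast_nonneg _
    nlinarith

/-- Every virtual point of the segment is close to the quasi-geodesic. -/
theorem morse_one (K L e : ℝ) (hK : 0 ≤ K) (hL : 0 ≤ L) :
    ∃ D0 : ℕ, ∀ (d : X → X → ℝ), IsPseudometric d → FourPt d K → ∀ (n : ℕ) (γ : ℕ → X),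
      (∀ i j, i ≤ j → j ≤ n → d (γ i) (γ j) ≤ L * ((j : ℝ) - i) ∧
        (j : ℝ) - i ≤ L * d (γ i) (γ j) + e) →
      ∀ s, 0 ≤ s → s ≤ d (γ 0) (γ n) → ∃ i ≤ n, vdist d (γ 0) (γ n) s (γ i) ≤ D0 := by
  obtain ⟨D0, hD0⟩ := exists_D0 K L e hK hL
  refine ⟨D0, fun d hp h4 n γ hγ => ?_⟩
  set l := d (γ 0) (γ n) with hl
  let Q : ℕ → Prop := fun D => ∀ s, 0 ≤ s → s ≤ l → ∃ i ≤ n, vdist d (γ 0) (γ n) s (γ i) ≤ D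
  have hex : ∃ D, Q D := by
    obtain ⟨D, hD⟩ := exists_nat_ge l
    refine ⟨D, fun s hs hs' => ⟨0, Nat.zero_le _, ?_⟩⟩
    rw [vdist_left hp _ _ _ hs]
    linarith
  classical
  by_cases hlt : Nat.find hex ≤ D0
  · intro s hs hs'
    obtain ⟨i, hi, h⟩ := Nat.find_spec hex s hs hs'
    exact ⟨i, hi, h.trans (by exact_mod_cast hlt)⟩
  exfalso
  push Not at hlt
  set D := Nat.find hex with hDdef
  have hDspec : Q D := Nat.find_spec hex
  have hDpos : 0 < D := by omega
  have hnot : ¬ Q (D - 1) := Nat.find_min hex (by omega)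
  obtain ⟨r, hr1, hr2⟩ := hD0 D hlt.le
  simp only [Q] at hnot
  push Not at hnot
  obtain ⟨s, hs0, hsl, hfar⟩ := hnot
  have hcast : ((D - 1 : ℕ) : ℝ) = (D : ℝ) - 1 := by
    rw [Nat.cast_sub (by omega)]; simp
  rw [hcast] at hfar
  have hDr : (0 : ℝ) < D := by exact_mod_cast hDpos
  -- left point
  obtain ⟨i, hi, hi1, hi2⟩ : ∃ i ≤ n, d (γ 0) (γ i) ≤ max (s - D) 0 ∧
      vdist d (γ 0) (γ n) s (γ i) ≤ 3 * D := by
    by_cases hc : s ≤ 2 * D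
    · refine ⟨0, Nat.zero_le _, ?_, ?_⟩
      · rw [hp.1]; exact le_max_right _ _
      · rw [vdist_left hp _ _ _ hs0]; linarith
    · obtain ⟨i, hi, h⟩ := hDspec (s - 2 * D) (by linarith) (by linarith)
      refine ⟨i, hi, ?_, ?_⟩
      · have := (le_max_left _ _).trans h
        exact le_trans (by linarith) (le_max_left _ _)
      · have := vdist_param (d := d) (γ 0) (γ n) s (s - 2 * D) (γ i)
        rw [show s - (s - 2 * (D : ℝ)) = 2 * D by ring, abs_of_pos (by linarith)] at this
        linarith
  obtain ⟨j, hj, hj1, hj2⟩ : ∃ j ≤ n, d (γ n) (γ j) ≤ max (l - s - D) 0 ∧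
      vdist d (γ 0) (γ n) s (γ j) ≤ 3 * D := by
    by_cases hc : l - s ≤ 2 * D
    · refine ⟨n, le_rfl, ?_, ?_⟩
      · rw [hp.1]; exact le_max_right _ _
      · rw [vdist_right hp _ _ _ hsl]; linarith
    · obtain ⟨j, hj, h⟩ := hDspec (s + 2 * D) (by linarith) (by linarith)
      refine ⟨j, hj, ?_, ?_⟩
      · have := (le_max_right _ _).trans h
        exact le_trans (by linarith) (le_max_left _ _)
      · have := vdist_param (d := d) (γ 0) (γ n) s (s + 2 * D) (γ j)
        rw [show s - (s + 2 * (D : ℝ)) = -(2 * D) by ring, abs_neg,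
          abs_of_pos (by linarith)] at this
        linarith
  have hi3 : d (γ 0) (γ i) ≤ s := hi1.trans (max_le (by linarith) hs0)
  have hj3 : d (γ n) (γ j) ≤ l - s := hj1.trans (max_le (by linarith) (by linarith))
  have hvi : vdist d (γ 0) (γ n) s (γ i) = d (γ n) (γ i) - (l - s) := by
    unfold vdist
    rw [max_eq_right]
    have := hp.2.2 (γ 0) (γ i) (γ n)
    rw [hp.2.1 (γ i)] at this
    rw [← hl] at *
    linarith
  have hvj : vdist d (γ 0) (γ n) s (γ j) = d (γ 0) (γ j) - s := by
    unfold vdist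
    rw [max_eq_left]
    have := hp.2.2 (γ 0) (γ j) (γ n)
    rw [hp.2.1 (γ j)] at this
    rw [← hl] at *
    linarith
  have hdij := vdist_pair h4 (γ 0) (γ n) s (γ i) (γ j)
  have hP : vdist d (γ 0) (γ n) s (γ i) + vdist d (γ 0) (γ n) s (γ j) - d (γ i) (γ j) ≤ K := by
    rw [hvi, hvj]
    have := h4 (γ n) (γ i) (γ 0) (γ j)
    rw [hp.2.1 (γ n) (γ 0), ← hl, hp.2.1 (γ i) (γ 0)] at this
    have h5 : max (l + d (γ i) (γ j)) (d (γ n) (γ j) + d (γ 0) (γ i)) ≤ l + d (γ i) (γ j) := by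
      apply max_le le_rfl
      have := pm_nonneg hp (γ i) (γ j)
      linarith
    linarith
  have hchain := chain_log (fun a b => vdist d (γ 0) (γ n) s (γ a) + vdist d (γ 0) (γ n) s (γ b)
    - d (γ a) (γ b)) K (2 * ((D : ℝ) - 1) - L) hK
    (fun a b c => vdist_hyp hp h4 (γ 0) (γ n) s (γ a) (γ b) (γ c)) n
    (fun a ha => by
      have := hfar a ha
      simp only [hp.1]
      linarith)
    (fun a ha => by
      have h1 := hfar a (by omega)
      have h2 := hfar (a + 1) ha
      have h3 := (hγ a (a + 1) (by omega) ha).1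
      push_cast at h3
      have h4 : L * ((a : ℝ) + 1 - a) = L := by ring
      linarith) r
  have hbound : L * d (γ i) (γ j) + e ≤ 2 ^ r := by
    refine le_trans ?_ hr1
    have : d (γ i) (γ j) ≤ 6 * D + K := by linarith
    have := mul_le_mul_of_nonneg_left this hL
    linarith
  rcases le_total i j with hij | hij
  · have h1 := (hγ i j hij hj).2
    have h2 : j ≤ i + 2 ^ r := by
      have : (j : ℝ) ≤ i + 2 ^ r := by linarith
      exact_mod_cast this
    have := hchain i j hij hj h2
    linarith
  · have h1 := (hγ j i hij hi).2
    rw [hp.2.1 (γ j)] at h1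
    have h2 : i ≤ j + 2 ^ r := by
      have : (i : ℝ) ≤ j + 2 ^ r := by linarith
      exact_mod_cast this
    have := hchain j i hij hi h2
    rw [hp.2.1 (γ j)] at this
    linarith

/-- Morse lemma: points of a quasi-geodesic have bounded excess. -/
theorem morse_two (K L e : ℝ) (hK : 0 ≤ K) (hL : 0 ≤ L) :
    ∃ C : ℝ, ∀ (d : X → X → ℝ), IsPseudometric d → FourPt d K → ∀ (n : ℕ) (γ : ℕ → X),
      (∀ i j, i ≤ j → j ≤ n → d (γ i) (γ j) ≤ L * ((j : ℝ) - i) ∧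
        (j : ℝ) - i ≤ L * d (γ i) (γ j) + e) →
      ∀ m ≤ n, d (γ 0) (γ m) + d (γ n) (γ m) - d (γ 0) (γ n) ≤ C := by
  obtain ⟨D0, hD0⟩ := morse_one (X := X) K L e hK hL
  refine ⟨2 * (D0 + L * (L * (2 * D0 + 1 + K) + e)), fun d hp h4 n γ hγ m hm => ?_⟩
  have H := hD0 d hp h4 n γ hγ
  set l := d (γ 0) (γ n) with hl
  have hl0 : 0 ≤ l := pm_nonneg hp _ _
  obtain ⟨s, s', i, j, hss, him, hmj, hjn, hi, hj⟩ : ∃ (s s' : ℝ) (i j : ℕ), |s - s'| ≤ 1 ∧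
      i ≤ m ∧ m ≤ j ∧ j ≤ n ∧ vdist d (γ 0) (γ n) s (γ i) ≤ D0 ∧
      vdist d (γ 0) (γ n) s' (γ j) ≤ D0 := by
    let Q : ℕ → Prop := fun k => ∃ i ≤ m, vdist d (γ 0) (γ n) (min k l) (γ i) ≤ D0
    have hQ0 : Q 0 := by
      refine ⟨0, Nat.zero_le _, ?_⟩
      rw [Nat.cast_zero, min_eq_left hl0, vdist_left hp _ _ _ le_rfl]
      positivity
    by_cases hall : ∀ k, Q k
    · obtain ⟨k, hk⟩ := exists_nat_ge l
      obtain ⟨i, hi, h⟩ := hall k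
      rw [min_eq_right hk] at h
      refine ⟨l, l, i, n, by simp, hi, hm, le_rfl, h, ?_⟩
      rw [vdist_right hp _ _ _ le_rfl, ← hl, sub_self]
      positivity
    · have : ∃ k, Q k ∧ ¬ Q (k + 1) := by
        by_contra hcon
        push Not at hcon
        exact hall fun k => Nat.rec hQ0 (fun k hk => hcon k hk) k
      obtain ⟨k, ⟨i, hi, h⟩, hk2⟩ := this
      obtain ⟨j, hj, h'⟩ := H (min ((k + 1 : ℕ) : ℝ) l) (le_min (by positivity) hl0)
        (min_le_right _ _)
      refine ⟨_, _, i, j, ?_, hi, ?_, hj, h, h'⟩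
      · have := abs_min_sub_min_le_max (k : ℝ) l ((k + 1 : ℕ) : ℝ) l
        refine this.trans ?_
        push_cast
        simp
      · by_contra hc
        exact hk2 ⟨j, by omega, h'⟩
  have h1 := vdist_pair h4 (γ 0) (γ n) s (γ i) (γ j)
  have h2 := vdist_param (d := d) (γ 0) (γ n) s s' (γ j)
  have h3 := (hγ i j (him.trans hmj) hjn).2
  have h5 := (hγ i m him hm).1
  have h6 := vdist_lip hp (γ 0) (γ n) s (γ m) (γ i)
  have h7 : d (γ i) (γ j) ≤ 2 * D0 + 1 + K := by linarith
  have h8 := mul_le_mul_of_nonneg_left h7 hL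
  have h9 : (m : ℝ) ≤ j := by exact_mod_cast hmj
  have h10 : (m : ℝ) - i ≤ L * (2 * D0 + 1 + K) + e := by linarith
  have h11 := mul_le_mul_of_nonneg_left h10 hL
  have a1 : d (γ 0) (γ m) - s ≤ vdist d (γ 0) (γ n) s (γ m) := le_max_left _ _
  have a2 : d (γ n) (γ m) - (l - s) ≤ vdist d (γ 0) (γ n) s (γ m) := le_max_right _ _
  linarith

/-! ### Hyperbolicity of sums -/

/-- Any two points are joined by a discrete geodesic. -/
def DiscGeod (d : X → X → ℝ) : Prop :=
  ∀ x y : X, ∃ (n : ℕ) (γ : ℕ → X), γ 0 = x ∧ γ n = y ∧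
    ∀ i j : ℕ, i ≤ j → j ≤ n → d (γ i) (γ j) = (j : ℝ) - i

theorem morse_excess {d0 d : X → X → ℝ} {K0 K L e : ℝ} (hp0 : IsPseudometric d0)
    (h0 : FourPt d0 K0) (hgeo : DiscGeod d0) (hp : IsPseudometric d) (h : FourPt d K)
    (hK0 : 0 ≤ K0) (hK : 0 ≤ K) (hL : 0 ≤ L) (hle : ∀ x y, d x y ≤ L * d0 x y)
    (hge : ∀ x y, d0 x y ≤ L * d x y + e) (C0 : ℝ) (hC0 : 0 ≤ C0) :
    ∃ C1 : ℝ, ∀ x y p, d0 x p + d0 y p - d0 x y ≤ C0 → d x p + d y p - d x y ≤ C1 := by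
  obtain ⟨C, hC⟩ := morse_two (X := X) K L e hK hL
  refine ⟨C + 2 * (L * (C0 + K0)), fun x y p hxyp => ?_⟩
  obtain ⟨n, γ, hx, hy, hγ⟩ := hgeo x y
  obtain ⟨n', γ', hx', hy', hγ'⟩ := hgeo x p
  have hxp : d0 x p = n' := by
    have := hγ' 0 n' (Nat.zero_le _) le_rfl
    rw [hx', hy'] at this
    simpa using this
  have hxy : d0 x y = n := by
    have := hγ 0 n (Nat.zero_le _) le_rfl
    rw [hx, hy] at this
    simpa using this
  have hM := hC d hp h n γ (fun i j hij hj => by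
    have e1 := hγ i j hij hj
    have e2 := hle (γ i) (γ j)
    have e3 := hge (γ i) (γ j)
    rw [e1] at e2 e3
    exact ⟨e2, e3⟩)
  have hq : ∃ m ≤ n, d0 p (γ m) ≤ C0 + K0 := by
    by_cases hc : n' ≤ n
    · refine ⟨n', hc, ?_⟩
      have e1 := hγ 0 n' (Nat.zero_le _) hc
      have e2 := hγ n' n hc le_rfl
      rw [hx] at e1
      rw [hy] at e2
      have e3 := h0 p (γ n') x y
      rw [hp0.2.1 p x, hp0.2.1 (γ n') x, hp0.2.1 p y] at e3
      simp only [Nat.cast_zero, sub_zero] at e1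
      have : max (d0 x p + d0 (γ n') y) (d0 y p + d0 x (γ n')) ≤ n + C0 := by
        apply max_le <;> linarith
      linarith
    · refine ⟨n, le_rfl, ?_⟩
      rw [hy, hp0.2.1 p y]
      have : (n : ℝ) ≤ n' := by exact_mod_cast (by omega : n ≤ n')
      linarith
  obtain ⟨m, hm, hpm⟩ := hq
  have e1 := hM m hm
  rw [hx, hy] at e1
  have e2 := hp.2.2 x (γ m) p
  have e3 := hp.2.2 y (γ m) p
  have e4 := hle p (γ m)
  have e5 := mul_le_mul_of_nonneg_left hpm hL
  rw [hp.2.1 (γ m) p] at e2 e3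
  linarith

theorem quad_order {d0 d : X → X → ℝ} {K0 K L e : ℝ} (hp0 : IsPseudometric d0)
    (h0 : FourPt d0 K0) (hgeo : DiscGeod d0) (hp : IsPseudometric d) (h : FourPt d K)
    (hK0 : 0 ≤ K0) (hK : 0 ≤ K) (hL : 0 ≤ L) (hle : ∀ x y, d x y ≤ L * d0 x y)
    (hge : ∀ x y, d0 x y ≤ L * d x y + e) :
    ∃ K' : ℝ, 0 ≤ K' ∧ ∀ x y z w, d0 x y + d0 z w ≤ d0 x z + d0 y w →
      d0 x y + d0 z w ≤ d0 x w + d0 y z →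
      d x y + d z w ≤ d x z + d y w + K' ∧ d x y + d z w ≤ d x w + d y z + K' := by
  obtain ⟨C1, hC1⟩ := morse_excess hp0 h0 hgeo hp h hK0 hK hL hle hge (4 * K0 + 4) (by linarith)
  refine ⟨2 * |C1|, by positivity, fun x y z w h12 h13 => ?_⟩
  have hC := le_abs_self C1
  have s0 := hp0.2.1
  have s := hp.2.1
  obtain ⟨n, γ, hx, hz, hγ⟩ := hgeo x z
  have hxz : d0 x z = n := by
    have := hγ 0 n (Nat.zero_le _) le_rfl
    rw [hx, hz] at this
    simpa using this
  set a := (d0 x y + d0 x z - d0 y z) / 2 with ha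
  have t1 := hp0.2.2 y x z
  have t2 := hp0.2.2 x z y
  have t3 := hp0.2.2 x y z
  rw [s0 y x] at t1
  rw [s0 z y] at t2
  have ha0 : 0 ≤ a := by linarith
  have han : a ≤ n := by linarith
  set k := ⌊a⌋₊ with hk
  have hk1 : (k : ℝ) ≤ a := Nat.floor_le ha0
  have hk2 : a < k + 1 := Nat.lt_floor_add_one a
  have hkn : k ≤ n := by exact_mod_cast hk1.trans han
  have g1 := hγ 0 k (Nat.zero_le _) hkn
  have g2 := hγ k n hkn le_rfl
  set p := γ k with hp'
  rw [hx] at g1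
  rw [hz, s0 p z] at g2
  simp only [Nat.cast_zero, sub_zero] at g1
  -- distance to `y`
  have py : d0 y p ≤ (d0 x y + d0 y z - d0 x z) / 2 + K0 + 1 := by
    have := h0 p y x z
    rw [s0 p y, s0 p x, s0 p z, s0 y x] at this
    have : max (d0 x p + d0 y z) (d0 z p + d0 x y) ≤ (d0 x y + d0 x z + d0 y z) / 2 + 1 := by
      apply max_le <;> linarith
    linarith
  have pw := h0 p w x z
  rw [s0 p w, s0 p x, s0 p z, s0 w z, s0 w x] at pw
  have h3 := h0 x w y z
  rw [s0 w z, s0 w y] at h3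
  have h32 : d0 x w + d0 y z ≤ d0 x z + d0 y w + K0 := by
    have : max (d0 x y + d0 z w) (d0 x z + d0 y w) ≤ d0 x z + d0 y w := max_le h12 le_rfl
    rw [s0 y w] at *
    linarith
  have exz := hC1 x z p (by linarith)
  have eyz := hC1 y z p (by linarith)
  have exw := hC1 x w p (by
    rcases max_choice (d0 x p + d0 z w) (d0 z p + d0 x w) with hm | hm <;> rw [hm] at pw <;> linarith)
  have eyw := hC1 y w p (by
    rcases max_choice (d0 x p + d0 z w) (d0 z p + d0 x w) with hm | hm <;> rw [hm] at pw <;> linarith)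
  have u1 := hp.2.2 x p y
  have u2 := hp.2.2 z p w
  rw [s p y] at u1
  rw [s p w] at u2
  constructor <;> linarith

theorem fourPt_sum {d0 d : X → X → ℝ} {K0 K L e : ℝ} (hp0 : IsPseudometric d0)
    (h0 : FourPt d0 K0) (hgeo : DiscGeod d0) (hp : IsPseudometric d) (h : FourPt d K)
    (hK0 : 0 ≤ K0) (hK : 0 ≤ K) (hL : 0 ≤ L) (hle : ∀ x y, d x y ≤ L * d0 x y)
    (hge : ∀ x y, d0 x y ≤ L * d x y + e) (a b : ℝ) (ha : 0 ≤ a) (hb : 0 ≤ b) :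
    ∃ K2 : ℝ, 0 ≤ K2 ∧ FourPt (fun x y => a * d x y + b * d0 x y) K2 := by
  obtain ⟨K', hK', hq⟩ := quad_order hp0 h0 hgeo hp h hK0 hK hL hle hge
  refine ⟨a * (K' + K) + b * K0, by positivity, fun x y z w => ?_⟩
  have s0 := hp0.2.1
  have s := hp.2.1
  have key : ∀ {A B A0 B0 : ℝ}, A ≤ B + (K' + K) → A0 ≤ B0 + K0 →
      a * A + b * A0 ≤ a * B + b * B0 + (a * (K' + K) + b * K0) := by
    intro A B A0 B0 h1 h2
    have := mul_le_mul_of_nonneg_left h1 ha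
    have := mul_le_mul_of_nonneg_left h2 hb
    linarith
  have f := h x y z w
  have f0 := h0 x y z w
  show (a * d x y + b * d0 x y) + (a * d z w + b * d0 z w) ≤
    max ((a * d x z + b * d0 x z) + (a * d y w + b * d0 y w))
      ((a * d x w + b * d0 x w) + (a * d y z + b * d0 y z)) + _
  have left : d x y + d z w ≤ d x z + d y w + (K' + K) →
      d0 x y + d0 z w ≤ d0 x z + d0 y w + K0 →
      (a * d x y + b * d0 x y) + (a * d z w + b * d0 z w) ≤
      max ((a * d x z + b * d0 x z) + (a * d y w + b * d0 y w))
      ((a * d x w + b * d0 x w) + (a * d y z + b * d0 y z)) + (a * (K' + K) + b * K0) := by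
    intro h1 h2
    have := key h1 h2
    have := le_max_left ((a * d x z + b * d0 x z) + (a * d y w + b * d0 y w))
      ((a * d x w + b * d0 x w) + (a * d y z + b * d0 y z))
    linarith
  have right : d x y + d z w ≤ d x w + d y z + (K' + K) →
      d0 x y + d0 z w ≤ d0 x w + d0 y z + K0 →
      (a * d x y + b * d0 x y) + (a * d z w + b * d0 z w) ≤
      max ((a * d x z + b * d0 x z) + (a * d y w + b * d0 y w))
      ((a * d x w + b * d0 x w) + (a * d y z + b * d0 y z)) + (a * (K' + K) + b * K0) := by
    intro h1 h2
    have := key h1 h2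
    have := le_max_right ((a * d x z + b * d0 x z) + (a * d y w + b * d0 y w))
      ((a * d x w + b * d0 x w) + (a * d y z + b * d0 y z))
    linarith
  by_cases c12 : d0 x y + d0 z w ≤ d0 x z + d0 y w
  · by_cases c13 : d0 x y + d0 z w ≤ d0 x w + d0 y z
    · exact left (by linarith [(hq x y z w c12 c13).1]) (by linarith)
    · -- third sum minimal
      have q := hq x w y z (by rw [s0 w z]; linarith) (by rw [s0 w y]; linarith)
      rw [s w z, s w y] at q
      refine left ?_ (by linarith)
      have : max (d x z + d y w) (d x w + d y z) ≤ d x z + d y w + K' :=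
        max_le (by linarith) (by linarith [q.2])
      linarith
  · by_cases c23 : d0 x z + d0 y w ≤ d0 x w + d0 y z
    · have q := hq x z y w (by linarith) (by rw [s0 z y]; linarith)
      rw [s z y] at q
      refine right ?_ ?_
      · have : max (d x z + d y w) (d x w + d y z) ≤ d x w + d y z + K' :=
          max_le (by linarith [q.2]) (by linarith)
        linarith
      · rw [max_eq_right c23] at f0
        exact f0
    · have q := hq x w y z (by rw [s0 w z]; linarith) (by rw [s0 w y]; linarith)
      rw [s w z, s w y] at q
      refine left ?_ ?_
      · have : max (d x z + d y w) (d x w + d y z) ≤ d x z + d y w + K' :=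
          max_le (by linarith) (by linarith [q.2])
        linarith
      · rw [max_eq_left (by linarith)] at f0
        exact f0

/-! ### Word metrics -/

theorem wordNorm_le_of_list (S : Set G) (l : List G) (hl : ∀ g ∈ l, g ∈ S) :
    wordNorm S l.prod ≤ l.length := by
  apply Nat.sInf_le
  refine ⟨fun i => l.get i, fun i => hl _ (List.get_mem _ _), ?_⟩
  rw [List.ofFn_get]

theorem exists_list_of_gen {S : Set G} (hS : GenSymm S) (g : G) :
    ∃ l : List G, (∀ s ∈ l, s ∈ S) ∧ l.prod = g := by
  have hg : g ∈ Subgroup.closure S := by rw [hS.2]; trivial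
  rw [← Subgroup.mem_toSubmonoid, Subgroup.closure_toSubmonoid] at hg
  obtain ⟨l, hl, h⟩ := Submonoid.exists_list_of_mem_closure hg
  refine ⟨l, fun s hs => ?_, h⟩
  rcases hl s hs with h | h
  · exact h
  · simpa using hS.1 _ h

theorem exists_list_wordNorm {S : Set G} (hS : GenSymm S) (g : G) :
    ∃ l : List G, (∀ s ∈ l, s ∈ S) ∧ l.prod = g ∧ l.length = wordNorm S g := by
  have hne : {k : ℕ | ∃ f : Fin k → G, (∀ i, f i ∈ S) ∧ (List.ofFn f).prod = g}.Nonempty := by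
    obtain ⟨l, hl, h⟩ := exists_list_of_gen hS g
    exact ⟨l.length, fun i => l.get i, fun i => hl _ (List.get_mem _ _), by rw [List.ofFn_get, h]⟩
  obtain ⟨f, hf, hg⟩ := Nat.sInf_mem hne
  refine ⟨List.ofFn f, ?_, hg, by rw [List.length_ofFn]; rfl⟩
  intro s hs
  obtain ⟨i, rfl⟩ := List.mem_ofFn.1 hs
  exact hf i

theorem wordNorm_one (S : Set G) : wordNorm S 1 = 0 := by
  have := wordNorm_le_of_list S [] (by simp)
  simpa using this

theorem wordNorm_mul {S : Set G} (hS : GenSymm S) (g h : G) :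
    wordNorm S (g * h) ≤ wordNorm S g + wordNorm S h := by
  obtain ⟨l, hl, rfl, e1⟩ := exists_list_wordNorm hS g
  obtain ⟨l', hl', rfl, e2⟩ := exists_list_wordNorm hS h
  rw [← e1, ← e2, ← List.prod_append, ← List.length_append]
  apply wordNorm_le_of_list
  intro s hs
  rcases List.mem_append.1 hs with h | h
  · exact hl s h
  · exact hl' s h

theorem wordNorm_inv_le {S : Set G} (hS : GenSymm S) (g : G) :
    wordNorm S g⁻¹ ≤ wordNorm S g := by
  obtain ⟨l, hl, rfl, e1⟩ := exists_list_wordNorm hS g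
  rw [← e1, List.prod_inv_reverse]
  refine (wordNorm_le_of_list S _ ?_).trans (by simp)
  intro s hs
  simp only [List.mem_reverse, List.mem_map] at hs
  obtain ⟨t, ht, rfl⟩ := hs
  exact hS.1 _ (hl t ht)

theorem wordDist_pm {S : Set G} (hS : GenSymm S) : IsPseudometric (wordDist S) := by
  have hle : ∀ x y : G, wordDist S x y ≤ wordDist S y x := by
    intro x y
    have := wordNorm_inv_le hS (y⁻¹ * x)
    rw [mul_inv_rev, inv_inv] at this
    unfold wordDist
    exact_mod_cast this
  refine ⟨fun x => ?_, fun x y => le_antisymm (hle x y) (hle y x), fun x y z => ?_⟩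
  · simp [wordDist, wordNorm_one]
  · have := wordNorm_mul hS (x⁻¹ * y) (y⁻¹ * z)
    rw [show x⁻¹ * y * (y⁻¹ * z) = x⁻¹ * z by group] at this
    unfold wordDist
    exact_mod_cast this

theorem wordDist_left (S : Set G) : LeftInvariant (wordDist S) := by
  intro g x y
  unfold wordDist
  rw [show (g * x)⁻¹ * (g * y) = x⁻¹ * y by group]

theorem wordDist_geod {S : Set G} (hS : GenSymm S) : DiscGeod (wordDist S) := by
  intro x y
  obtain ⟨l, hl, hp, e1⟩ := exists_list_wordNorm hS (x⁻¹ * y)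
  have hpm := wordDist_pm hS
  have hup : ∀ i j : ℕ, i ≤ j →
      wordDist S (x * (l.take i).prod) (x * (l.take j).prod) ≤ (j : ℝ) - i := by
    intro i j hij
    have h1 : (l.take j).prod = (l.take i).prod * ((l.drop i).take (j - i)).prod := by
      rw [← List.prod_append, ← List.take_add]
      congr 2; omega
    have h2 := wordNorm_le_of_list S ((l.drop i).take (j - i))
      (fun s hs => hl s (List.mem_of_mem_drop (List.mem_of_mem_take hs)))
    have h3 : ((l.drop i).take (j - i)).length ≤ j - i := List.length_take_le _ _
    rw [← Nat.cast_sub hij, h1, wordDist_left]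
    unfold wordDist
    rw [inv_mul_cancel_left]
    exact_mod_cast h2.trans h3
  refine ⟨l.length, fun i => x * (l.take i).prod, by simp, by simp [hp], fun i j hij hj => ?_⟩
  apply le_antisymm (hup i j hij)
  have a := hup 0 i (Nat.zero_le _)
  have b := hup j l.length hj
  have t1 := hpm.2.2 (x * (l.take 0).prod) (x * (l.take i).prod) (x * (l.take l.length).prod)
  have t2 := hpm.2.2 (x * (l.take i).prod) (x * (l.take j).prod) (x * (l.take l.length).prod)
  have c : wordDist S (x * (l.take 0).prod) (x * (l.take l.length).prod) = l.length := by
    rw [wordDist_left, List.take_length, hp, e1]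
    simp [wordDist]
  simp only [Nat.cast_zero, sub_zero] at a
  linarith

theorem le_wordDist {d : G → G → ℝ} (hp : IsPseudometric d) (hl : LeftInvariant d)
    {S : Finset G} (hS : GenSymm (S : Set G)) :
    ∃ B : ℝ, 0 ≤ B ∧ ∀ x y, d x y ≤ B * wordDist (S : Set G) x y := by
  refine ⟨∑ s ∈ S, d 1 s, Finset.sum_nonneg fun s _ => pm_nonneg hp _ _, fun x y => ?_⟩
  have hB : ∀ s ∈ S, d 1 s ≤ ∑ s ∈ S, d 1 s := fun s hs =>
    Finset.single_le_sum (f := fun s => d 1 s) (fun s _ => pm_nonneg hp _ _) hs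
  have key : ∀ l : List G, (∀ s ∈ l, s ∈ S) → d 1 l.prod ≤ (∑ s ∈ S, d 1 s) * l.length := by
    intro l
    induction l with
    | nil => intro _; simp [hp.1]
    | cons a l ih =>
      intro h
      have h1 := ih fun s hs => h s (List.mem_cons_of_mem _ hs)
      have h2 := hB a (h a List.mem_cons_self)
      have h3 := hp.2.2 1 a (a * l.prod)
      have h4 := hl a 1 l.prod
      rw [mul_one] at h4
      rw [List.prod_cons, List.length_cons]
      push_cast
      linarith
  obtain ⟨l, hl', hpr, e1⟩ := exists_list_wordNorm hS (x⁻¹ * y)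
  have := key l hl'
  rw [hpr, e1] at this
  have h4 := hl x 1 (x⁻¹ * y)
  rw [mul_one, mul_inv_cancel_left] at h4
  rw [h4]
  exact this

theorem finite_ball {S : Finset G} (hS : GenSymm (S : Set G)) (n : ℕ) :
    {g : G | wordNorm (S : Set G) g ≤ n}.Finite := by
  have : {g : G | wordNorm (S : Set G) g ≤ n} ⊆
      ⋃ k ∈ Finset.range (n + 1), (Set.range fun f : Fin k → S => (List.ofFn fun i => (f i : G)).prod) := by
    intro g hg
    obtain ⟨l, hl, hp, e⟩ := exists_list_wordNorm hS g
    simp only [Set.mem_iUnion, Finset.mem_range]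
    refine ⟨l.length, by rw [e]; exact Nat.lt_succ_of_le hg,
      fun i => ⟨l.get i, hl _ (List.get_mem _ _)⟩, ?_⟩
    simp only
    rw [List.ofFn_get, hp]
  refine Set.Finite.subset ?_ this
  exact Set.Finite.biUnion (Finset.finite_toSet _) fun k _ => Set.finite_range _

theorem infinite_of_nonElementary (hne : NonElementary G) : Infinite G := by
  by_contra h
  rw [not_infinite_iff_finite] at h
  refine hne ⟨⊥, inferInstance, ?_⟩
  intro a ha b hb
  rw [Subgroup.mem_bot] at ha hb
  rw [ha, hb]

theorem wordDist_unbdd {S : Finset G} (hS : GenSymm (S : Set G)) (hinf : Infinite G) (A : ℝ) :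
    ∃ x y : G, A < wordDist (S : Set G) x y := by
  by_contra hcon
  push Not at hcon
  obtain ⟨n, hn⟩ := exists_nat_ge A
  have := finite_ball hS n
  refine Set.infinite_univ (α := G) (this.subset fun g _ => ?_)
  have h1 := (hcon 1 g).trans hn
  unfold wordDist at h1
  rw [inv_one, one_mul] at h1
  exact_mod_cast h1

/-! ### Coarse domination, normalisation and the homotopy -/

/-- `d ≤ l d' + A` for some `A`. -/
def CD (l : ℝ) (d d' : G → G → ℝ) : Prop := ∃ A : ℝ, 0 ≤ A ∧ ∀ x y, d x y ≤ l * d' x y + A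

set_option linter.unusedSectionVars false in
theorem CD.trans {l m : ℝ} {d1 d2 d3 : G → G → ℝ} (hl : 0 ≤ l) (h : CD l d1 d2)
    (h' : CD m d2 d3) : CD (l * m) d1 d3 := by
  obtain ⟨A, hA, h⟩ := h
  obtain ⟨B, hB, h'⟩ := h'
  refine ⟨l * B + A, by positivity, fun x y => ?_⟩
  have := mul_le_mul_of_nonneg_left (h' x y) hl
  have := h x y
  linarith

set_option linter.unusedSectionVars false in
theorem CD.mono {l m : ℝ} {d1 d2 : G → G → ℝ} (hp : IsPseudometric d2) (hlm : l ≤ m)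
    (h : CD l d1 d2) : CD m d1 d2 := by
  obtain ⟨A, hA, h⟩ := h
  refine ⟨A, hA, fun x y => ?_⟩
  have := mul_le_mul_of_nonneg_right hlm (pm_nonneg hp x y)
  have := h x y
  linarith

set_option linter.unusedSectionVars false in
theorem RSim.cd {d d' : G → G → ℝ} (h : RSim d d') :
    ∃ k, 0 < k ∧ CD k d d' ∧ CD k⁻¹ d' d := by
  obtain ⟨k, A, hk, hA, h⟩ := h
  refine ⟨k, hk, ⟨A, hA, fun x y => ?_⟩, ⟨k⁻¹ * A, by positivity, fun x y => ?_⟩⟩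
  · have := (abs_le.1 (h x y)).2
    linarith
  · have h1 := (abs_le.1 (h x y)).1
    have h2 : k * d' x y ≤ d x y + A := by linarith
    have := mul_le_mul_of_nonneg_left h2 (inv_pos.2 hk).le
    rw [inv_mul_cancel_left₀ hk.ne'] at this
    linarith

theorem inD_qi {S : Finset G} (hS : GenSymm (S : Set G)) {d : G → G → ℝ} (hd : InD d) :
    ∃ L e : ℝ, 0 < L ∧ 0 ≤ e ∧ (∀ x y, d x y ≤ L * wordDist (S : Set G) x y) ∧
      ∀ x y, wordDist (S : Set G) x y ≤ L * d x y + e := by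
  obtain ⟨hp, hl, -, S', hS', l1, l2, e, hl1, hl2, he, hq⟩ := hd
  obtain ⟨B, hB, h1⟩ := le_wordDist hp hl hS
  obtain ⟨B', hB', h2⟩ := le_wordDist (wordDist_pm hS) (wordDist_left _) hS'
  refine ⟨B + B' * l1 + 1, B' * l1 * e, by positivity, by positivity, fun x y => ?_, fun x y => ?_⟩
  · have := pm_nonneg (wordDist_pm hS) x y
    have : 0 ≤ (B' * l1 + 1) * wordDist (S : Set G) x y := by positivity
    linarith [h1 x y]
  · have h3 := (hq x y).1
    have h4 : wordDist (S' : Set G) x y ≤ l1 * (d x y + e) := by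
      rw [sub_le_iff_le_add, div_le_iff₀ hl1] at h3
      linarith
    have h5 := mul_le_mul_of_nonneg_left h4 hB'
    have := pm_nonneg hp x y
    have : 0 ≤ (B + 1) * d x y := by positivity
    linarith [h2 x y]

theorem inD_comb {S : Finset G} (hS : GenSymm (S : Set G)) {δ : ℝ} (hδ : 0 ≤ δ)
    (hyp : GromovHyperbolic (wordDist (S : Set G)) δ) {d : G → G → ℝ} (hd : InD d)
    {a b : ℝ} (ha : 0 ≤ a) (hb : 0 ≤ b) (hab : 0 < a + b) :
    InD (fun x y => a * d x y + b * wordDist (S : Set G) x y) := by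
  obtain ⟨L, e, hL, he, hle, hge⟩ := inD_qi hS hd
  have hp0 := wordDist_pm hS
  obtain ⟨hp, hl, ⟨δ', hδ', hyp'⟩, -⟩ := hd
  have hpm : IsPseudometric (fun x y => a * d x y + b * wordDist (S : Set G) x y) := by
    refine ⟨fun x => by simp [hp.1, hp0.1], fun x y => ?_, fun x y z => ?_⟩
    · simp only
      rw [hp.2.1 x y, hp0.2.1 x y]
    · have := mul_le_mul_of_nonneg_left (hp.2.2 x y z) ha
      have := mul_le_mul_of_nonneg_left (hp0.2.2 x y z) hb
      simp only
      linarith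
  obtain ⟨K2, hK2, hF⟩ := fourPt_sum hp0 (fourPt_of_hyp hp0 hyp) (wordDist_geod hS) hp
    (fourPt_of_hyp hp hyp') (by positivity) (by positivity) hL.le hle hge a b ha hb
  refine ⟨hpm, fun g x y => ?_, ⟨K2 / 2, by positivity, hyp_of_fourPt hpm hF⟩, S, hS, ?_⟩
  · simp only
    rw [hl, wordDist_left]
  · refine ⟨(L + 1) / (a + b), a * L + b + 1, a * e, by positivity, by positivity, by positivity,
      fun x y => ⟨?_, ?_⟩⟩
    · have h1 := mul_le_mul_of_nonneg_left (hge x y) ha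
      have h2 := pm_nonneg hp x y
      have h3 := pm_nonneg hp0 x y
      rw [div_div_eq_mul_div, sub_le_iff_le_add, div_le_iff₀ (by positivity)]
      have h4 : 0 ≤ a * d x y := by positivity
      have h5 : 0 ≤ b * L * wordDist (S : Set G) x y := by positivity
      have h6 : 0 ≤ a * e * L := by positivity
      nlinarith
    · have h1 := mul_le_mul_of_nonneg_left (hle x y) ha
      have h3 := pm_nonneg hp0 x y
      have : 0 ≤ a * e := by positivity
      simp only
      linarith

theorem inD_unbdd (hinf : Infinite G) {d : G → G → ℝ} (hd : InD d) (A : ℝ) :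
    ∃ x y, A < d x y := by
  obtain ⟨hp, -, -, S', hS', -⟩ := id hd
  obtain ⟨L, e, hL, he, hle, hge⟩ := inD_qi hS' hd
  obtain ⟨x, y, h⟩ := wordDist_unbdd hS' hinf (L * A + e)
  refine ⟨x, y, ?_⟩
  have := hge x y
  by_contra hc
  push Not at hc
  have := mul_le_mul_of_nonneg_left hc hL.le
  linarith

theorem cd_self_ge (hinf : Infinite G) {d : G → G → ℝ} (hd : InD d) {l : ℝ} (h : CD l d d) :
    1 ≤ l := by
  obtain ⟨A, hA, h⟩ := h
  by_contra hc
  push Not at hc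
  have hpos : 0 < 1 - l := by linarith
  obtain ⟨x, y, hxy⟩ := inD_unbdd hinf hd (A / (1 - l))
  rw [div_lt_iff₀ hpos] at hxy
  have := h x y
  linarith

set_option linter.unusedSectionVars false in
/-- The set defining `Lam`. -/
theorem lam_set_iff {d1 d2 : G → G → ℝ} {l : ℝ} :
    (∃ l1 l2 A : ℝ, 0 < l1 ∧ 0 < l2 ∧ 0 ≤ A ∧ l = l1 * l2 ∧
      ∀ x y : G, d2 x y / l1 - A ≤ d1 x y ∧ d1 x y ≤ l2 * d2 x y + A) ↔
    ∃ l1 l2 : ℝ, 0 < l1 ∧ 0 < l2 ∧ l = l1 * l2 ∧ CD l1 d2 d1 ∧ CD l2 d1 d2 := by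
  constructor
  · rintro ⟨l1, l2, A, h1, h2, hA, hl, h⟩
    refine ⟨l1, l2, h1, h2, hl, ⟨l1 * A, by positivity, fun x y => ?_⟩,
      ⟨A, hA, fun x y => (h x y).2⟩⟩
    have := (h x y).1
    rw [sub_le_iff_le_add, div_le_iff₀ h1] at this
    linarith
  · rintro ⟨l1, l2, h1, h2, hl, ⟨A, hA, hA'⟩, ⟨B, hB, hB'⟩⟩
    refine ⟨l1, l2, A / l1 + B, h1, h2, by positivity, hl, fun x y => ⟨?_, ?_⟩⟩
    · have := hA' x y
      have h3 : d2 x y / l1 ≤ d1 x y + A / l1 := by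
        rw [div_le_iff₀ h1, add_mul, div_mul_cancel₀ _ h1.ne']
        linarith
      linarith
    · have := hB' x y
      have : 0 ≤ A / l1 := by positivity
      linarith

theorem lam_nonempty {d1 d2 : G → G → ℝ} (h1 : InD d1) (h2 : InD d2) :
    {l : ℝ | ∃ l1 l2 A : ℝ, 0 < l1 ∧ 0 < l2 ∧ 0 ≤ A ∧ l = l1 * l2 ∧
      ∀ x y : G, d2 x y / l1 - A ≤ d1 x y ∧ d1 x y ≤ l2 * d2 x y + A}.Nonempty := by
  obtain ⟨-, -, -, S, hS, -⟩ := id h1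
  obtain ⟨L, e, hL, he, hle, hge⟩ := inD_qi hS h1
  obtain ⟨L', e', hL', he', hle', hge'⟩ := inD_qi hS h2
  refine ⟨_, lam_set_iff.2 ⟨L' * L, L * L', by positivity, by positivity, rfl, ?_, ?_⟩⟩
  · exact CD.trans hL'.le ⟨0, le_rfl, by simpa using hle'⟩ ⟨e, he, hge⟩
  · exact CD.trans hL.le ⟨0, le_rfl, by simpa using hle⟩ ⟨e', he', hge'⟩

theorem lam_mem_ge (hinf : Infinite G) {d1 d2 : G → G → ℝ} (h2 : InD d2)
    {l1 l2 : ℝ} (hl1 : 0 < l1) (c1 : CD l1 d2 d1) (c2 : CD l2 d1 d2) : 1 ≤ l1 * l2 :=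
  cd_self_ge hinf h2 (c1.trans hl1.le c2)

theorem lam_ge_one (hinf : Infinite G) {d1 d2 : G → G → ℝ} (h1 : InD d1) (h2 : InD d2) :
    1 ≤ Lam d1 d2 := by
  refine le_csInf (lam_nonempty h1 h2) ?_
  intro l hl
  obtain ⟨l1, l2, hl1, hl2, rfl, c1, c2⟩ := lam_set_iff.1 hl
  exact lam_mem_ge hinf h2 hl1 c1 c2

theorem lam_le (hinf : Infinite G) {d1 d2 : G → G → ℝ} (h2 : InD d2)
    {l1 l2 : ℝ} (hl1 : 0 < l1) (hl2 : 0 < l2) (c1 : CD l1 d2 d1) (c2 : CD l2 d1 d2) :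
    Lam d1 d2 ≤ l1 * l2 := by
  refine csInf_le ⟨1, ?_⟩ (lam_set_iff.2 ⟨l1, l2, hl1, hl2, rfl, c1, c2⟩)
  intro l hl
  obtain ⟨l1, l2, hl1, hl2, rfl, c1, c2⟩ := lam_set_iff.1 hl
  exact lam_mem_ge hinf h2 hl1 c1 c2

theorem delta_inner_ge (hinf : Infinite G) (ρ1 ρ2 : MetricStructures G) :
    1 ≤ sInf {l : ℝ | ∃ d1 d2 : DSub G,
      Quotient.mk (rsSetoid G) d1 = ρ1 ∧ Quotient.mk (rsSetoid G) d2 = ρ2 ∧ l = Lam d1.1 d2.1} := by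
  refine le_csInf ⟨_, Quotient.out ρ1, Quotient.out ρ2, Quotient.out_eq _, Quotient.out_eq _, rfl⟩ ?_
  rintro l ⟨d1, d2, -, -, rfl⟩
  exact lam_ge_one hinf d1.2 d2.2

theorem delta_lt (hinf : Infinite G) (d1 d2 : DSub G) {l1 l2 ε : ℝ} (hl1 : 0 < l1) (hl2 : 0 < l2)
    (c1 : CD l1 d2.1 d1.1) (c2 : CD l2 d1.1 d2.1) (h : l1 * l2 < Real.exp ε) :
    Delta (Quotient.mk (rsSetoid G) d1 : MetricStructures G)
      (Quotient.mk (rsSetoid G) d2 : MetricStructures G) < ε := by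
  unfold Delta
  have hge := delta_inner_ge hinf (Quotient.mk (rsSetoid G) d1 : MetricStructures G)
    (Quotient.mk (rsSetoid G) d2 : MetricStructures G)
  rw [Real.log_lt_iff_lt_exp (by linarith)]
  refine lt_of_le_of_lt ?_ h
  refine le_trans (csInf_le ⟨1, ?_⟩ ⟨d1, d2, rfl, rfl, rfl⟩) (lam_le hinf d2.2 hl1 hl2 c1 c2)
  rintro l ⟨d1, d2, -, -, rfl⟩
  exact lam_ge_one hinf d1.2 d2.2

theorem delta_extract (hinf : Infinite G) (ρ ρ' : MetricStructures G) {η : ℝ}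
    (h : Delta ρ ρ' < η) : ∃ l1 l2 : ℝ, 0 < l1 ∧ 0 < l2 ∧ l1 * l2 < Real.exp η ∧
      CD l1 (Quotient.out ρ').1 (Quotient.out ρ).1 ∧
      CD l2 (Quotient.out ρ).1 (Quotient.out ρ').1 := by
  have hge := delta_inner_ge hinf ρ ρ'
  unfold Delta at h
  rw [Real.log_lt_iff_lt_exp (by linarith)] at h
  have hne : {l : ℝ | ∃ d1 d2 : DSub G, Quotient.mk (rsSetoid G) d1 = ρ ∧
      Quotient.mk (rsSetoid G) d2 = ρ' ∧ l = Lam d1.1 d2.1}.Nonempty :=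
    ⟨_, Quotient.out ρ, Quotient.out ρ', Quotient.out_eq _, Quotient.out_eq _, rfl⟩
  obtain ⟨_, ⟨d1, d2, e1, e2, rfl⟩, h2⟩ := exists_lt_of_csInf_lt hne h
  obtain ⟨_, hm, h3⟩ := exists_lt_of_csInf_lt (lam_nonempty d1.2 d2.2) h2
  obtain ⟨l1, l2, hl1, hl2, rfl, c1, c2⟩ := lam_set_iff.1 hm
  have r1 : RSim d1.1 (Quotient.out ρ).1 :=
    Quotient.exact (s := rsSetoid G) (e1.trans (Quotient.out_eq ρ).symm)
  have r2 : RSim d2.1 (Quotient.out ρ').1 :=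
    Quotient.exact (s := rsSetoid G) (e2.trans (Quotient.out_eq ρ').symm)
  obtain ⟨k, hk, a1, a2⟩ := r1.cd
  obtain ⟨k', hk', b1, b2⟩ := r2.cd
  refine ⟨k'⁻¹ * (l1 * k), k⁻¹ * (l2 * k'), by positivity, by positivity, ?_, ?_, ?_⟩
  · have : k'⁻¹ * (l1 * k) * (k⁻¹ * (l2 * k')) = l1 * l2 := by field_simp
    rw [this]; exact h3
  · exact b2.trans (by positivity) (c1.trans hl1.le a1)
  · exact a2.trans (by positivity) (c2.trans hl2.le b1)

/-- Normalising constant of `d` relative to `d0`. -/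
def Nrm (d0 d : G → G → ℝ) : ℝ := sInf {l : ℝ | 0 < l ∧ CD l d d0}

theorem nrm_pos (hinf : Infinite G) {S : Finset G} (hS : GenSymm (S : Set G)) {d : G → G → ℝ}
    (hd : InD d) : 0 < Nrm (wordDist (S : Set G)) d := by
  obtain ⟨L, e, hL, he, hle, hge⟩ := inD_qi hS hd
  refine lt_of_lt_of_le (inv_pos.2 hL) (le_csInf ⟨L, hL, 0, le_rfl, by simpa using hle⟩ ?_)
  rintro l ⟨hl, hc⟩
  have := cd_self_ge hinf hd (hc.trans hl.le ⟨e, he, hge⟩)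
  rw [inv_le_iff_one_le_mul₀ hL]
  exact this

theorem nrm_le {S : Finset G} (hS : GenSymm (S : Set G)) {d d' : G → G → ℝ}
    (hd' : InD d') {l : ℝ} (hl : 0 < l) (h : CD l d d') :
    Nrm (wordDist (S : Set G)) d ≤ l * Nrm (wordDist (S : Set G)) d' := by
  obtain ⟨L, e, hL, he, hle, hge⟩ := inD_qi hS hd'
  rw [← div_le_iff₀' hl]
  refine le_csInf ⟨L, hL, 0, le_rfl, by simpa using hle⟩ ?_
  rintro m ⟨hm, hc⟩
  rw [div_le_iff₀' hl]
  refine csInf_le ⟨0, fun x hx => hx.1.le⟩ ⟨by positivity, h.trans hl.le hc⟩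

/-- The convex combination used for the homotopy. -/
def mix (d0 d : G → G → ℝ) (t : ℝ) : G → G → ℝ :=
  fun x y => t / Nrm d0 d * d x y + (1 - t) * d0 x y

theorem mix_inD (hinf : Infinite G) {S : Finset G} (hS : GenSymm (S : Set G)) {δ : ℝ} (hδ : 0 ≤ δ)
    (hyp : GromovHyperbolic (wordDist (S : Set G)) δ) {d : G → G → ℝ} (hd : InD d)
    {t : ℝ} (ht : t ∈ Set.Icc (0 : ℝ) 1) : InD (mix (wordDist (S : Set G)) d t) := by
  have hN := nrm_pos hinf hS hd
  have h1 : 0 ≤ t / Nrm (wordDist (S : Set G)) d := div_nonneg ht.1 hN.le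
  have h2 : 0 ≤ 1 - t := by linarith [ht.2]
  refine inD_comb hS hδ hyp hd h1 h2 ?_
  rcases ht.1.eq_or_lt with h | h
  · rw [← h]; simp
  · have : 0 < t / Nrm (wordDist (S : Set G)) d := div_pos h hN
    linarith

/-- Changing the metric in `mix`. -/
theorem mix_cd_metric (hinf : Infinite G) {S : Finset G} (hS : GenSymm (S : Set G))
    {d d' : G → G → ℝ} (hd : InD d) (hd' : InD d') {l1 l2 : ℝ} (hl1 : 0 < l1) (hl2 : 0 < l2)
    (c1 : CD l1 d' d) (c2 : CD l2 d d') {s : ℝ} (hs : s ∈ Set.Icc (0 : ℝ) 1) :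
    CD (l1 * l2) (mix (wordDist (S : Set G)) d' s) (mix (wordDist (S : Set G)) d s) := by
  have hN := nrm_pos hinf hS hd
  have hN' := nrm_pos hinf hS hd'
  have hNN := nrm_le hS hd' hl2 c2
  have hone : 1 ≤ l1 * l2 := by
    exact cd_self_ge hinf hd' (c1.trans hl1.le c2)
  obtain ⟨A, hA, hc⟩ := c1
  set N := Nrm (wordDist (S : Set G)) d with hNdef
  set N' := Nrm (wordDist (S : Set G)) d' with hNdef'
  have hs0 : 0 ≤ s := hs.1
  refine ⟨s / N' * A, by positivity, fun x y => ?_⟩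
  have e1 : 0 ≤ s / N' := by positivity
  have h1 := mul_le_mul_of_nonneg_left (hc x y) e1
  have h2 := pm_nonneg hd.1 x y
  have h3 := pm_nonneg (wordDist_pm hS) x y
  have h4 : s / N' * l1 ≤ l1 * l2 * (s / N) := by
    rw [div_mul_eq_mul_div, mul_div_assoc', div_le_div_iff₀ hN' hN]
    have := mul_le_mul_of_nonneg_left hNN (by positivity : 0 ≤ s * l1)
    linarith
  have h5 := mul_le_mul_of_nonneg_right h4 h2
  have h6 : 0 ≤ (1 - s) * wordDist (S : Set G) x y := mul_nonneg (by linarith [hs.2]) h3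
  have h7 := mul_le_mul_of_nonneg_right hone h6
  simp only [mix]
  rw [← hNdef, ← hNdef']
  linarith

/-- Changing the parameter in `mix`. -/
theorem mix_cd_param (hinf : Infinite G) {S : Finset G} (hS : GenSymm (S : Set G))
    {d : G → G → ℝ} (hd : InD d) : ∃ C : ℝ, 0 ≤ C ∧ ∀ s ∈ Set.Icc (0 : ℝ) 1,
      ∀ t ∈ Set.Icc (0 : ℝ) 1, CD (1 + |s - t| * C) (mix (wordDist (S : Set G)) d s)
        (mix (wordDist (S : Set G)) d t) := by
  have hN := nrm_pos hinf hS hd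
  obtain ⟨L, e, hL, he, hle, hge⟩ := inD_qi hS hd
  set N := Nrm (wordDist (S : Set G)) d with hNdef
  refine ⟨1 + L * N + L / N, by positivity, fun s hs t ht => ⟨|s - t| * e, by positivity, ?_⟩⟩
  intro x y
  have h2 := pm_nonneg hd.1 x y
  have h3 := pm_nonneg (wordDist_pm hS) x y
  simp only [mix]
  rw [← hNdef]
  have r1 : s / N * d x y = s * (d x y / N) := by ring
  have r2 : t / N * d x y = t * (d x y / N) := by ring
  rw [r1, r2]
  set u := d x y / N with hu
  set v := wordDist (S : Set G) x y with hv
  have hu0 : 0 ≤ u := by positivity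
  have huv : u ≤ L / N * v := by
    rw [hu, div_mul_eq_mul_div]
    exact div_le_div_of_nonneg_right (hle x y) hN.le
  have hvu : v ≤ L * N * u + e := by
    have : L * N * u = L * d x y := by rw [hu]; field_simp
    rw [this]
    exact hge x y
  have ht0 := ht.1
  have ht1 : 0 ≤ 1 - t := by linarith [ht.2]
  have k1 : u + v ≤ (1 + L * N + L / N) * u + e := by
    have : 0 ≤ L / N * u := by positivity
    linarith
  have k2 : u + v ≤ (1 + L * N + L / N) * v + e := by
    have : 0 ≤ L * N * v := by positivity
    linarith
  have k3 : u + v ≤ (1 + L * N + L / N) * (t * u + (1 - t) * v) + e := by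
    have := mul_le_mul_of_nonneg_left k1 ht0
    have := mul_le_mul_of_nonneg_left k2 ht1
    linarith
  have k4 := mul_le_mul_of_nonneg_left k3 (abs_nonneg (s - t))
  have k5 : (s - t) * u ≤ |s - t| * u := mul_le_mul_of_nonneg_right (le_abs_self _) hu0
  have k6 : (t - s) * v ≤ |s - t| * v :=
    mul_le_mul_of_nonneg_right (by rw [abs_sub_comm]; exact le_abs_self _) h3
  linarith

/-- `(𝒟(G), Δ)` is contractible: there is a homotopy `H` from the
identity to a constant map which is jointly continuous for the metric `Δ`
(and the usual metric on `[0,1]`). -/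
theorem metric_structures_contractible (G : Type*) [Group G]
    (hG : IsHyperbolicGroup G) (hne : NonElementary G) :
    ∃ (ρ0 : MetricStructures G) (H : MetricStructures G → ℝ → MetricStructures G),
      (∀ ρ, H ρ 0 = ρ0) ∧ (∀ ρ, H ρ 1 = ρ) ∧
      (∀ (ρ : MetricStructures G) (t : ℝ), t ∈ Set.Icc (0 : ℝ) 1 →
        ∀ ε : ℝ, 0 < ε → ∃ η : ℝ, 0 < η ∧
          ∀ (ρ' : MetricStructures G) (s : ℝ), s ∈ Set.Icc (0 : ℝ) 1 →
            Delta ρ ρ' < η → |s - t| < η → Delta (H ρ t) (H ρ' s) < ε) := by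
  have hinf := infinite_of_nonElementary hne
  obtain ⟨S, hS, δ, hδ, hyp⟩ := hG
  classical
  have hw : InD (wordDist (S : Set G)) :=
    ⟨wordDist_pm hS, wordDist_left _, ⟨δ, hδ, hyp⟩, S, hS, 1, 1, 0, one_pos, one_pos, le_rfl,
      fun x y => by simp⟩
  have hmix : ∀ (ρ : MetricStructures G) (t : ℝ), t ∈ Set.Icc (0 : ℝ) 1 →
      InD (mix (wordDist (S : Set G)) (Quotient.out ρ).1 t) :=
    fun ρ t ht => mix_inD hinf hS hδ hyp (Quotient.out ρ).2 ht
  let ρ0 : MetricStructures G := Quotient.mk (rsSetoid G) (⟨wordDist (S : Set G), hw⟩ : DSub G)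
  let H : MetricStructures G → ℝ → MetricStructures G := fun ρ t =>
    if ht : t ∈ Set.Icc (0 : ℝ) 1 then
      Quotient.mk (rsSetoid G) (⟨mix (wordDist (S : Set G)) (Quotient.out ρ).1 t, hmix ρ t ht⟩ : DSub G)
    else ρ0
  have hH : ∀ ρ t (ht : t ∈ Set.Icc (0 : ℝ) 1), H ρ t = Quotient.mk (rsSetoid G)
      (⟨mix (wordDist (S : Set G)) (Quotient.out ρ).1 t, hmix ρ t ht⟩ : DSub G) :=
    fun ρ t ht => dif_pos ht
  refine ⟨ρ0, H, fun ρ => ?_, fun ρ => ?_, fun ρ t ht ε hε => ?_⟩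
  · rw [hH ρ 0 ⟨le_rfl, zero_le_one⟩]
    apply Quotient.sound (s := rsSetoid G)
    refine ⟨1, 0, one_pos, le_rfl, fun x y => ?_⟩
    simp [mix]
  · rw [hH ρ 1 ⟨zero_le_one, le_rfl⟩]
    refine Eq.trans ?_ (Quotient.out_eq ρ)
    apply Quotient.sound (s := rsSetoid G)
    have hN := nrm_pos hinf hS (Quotient.out ρ).2
    refine ⟨1 / Nrm (wordDist (S : Set G)) (Quotient.out ρ).1, 0, by positivity, le_rfl,
      fun x y => ?_⟩
    simp [mix]
  · obtain ⟨C, hC, hpar⟩ := mix_cd_param hinf hS (Quotient.out ρ).2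
    refine ⟨ε / (4 * (C + 1)), by positivity, fun ρ' s hs hΔ hst => ?_⟩
    set η := ε / (4 * (C + 1)) with hη
    have hη0 : 0 < η := by positivity
    obtain ⟨l1, l2, hl1, hl2, hl, c1, c2⟩ := delta_extract hinf ρ ρ' hΔ
    have a1 := mix_cd_metric hinf hS (Quotient.out ρ).2 (Quotient.out ρ').2 hl1 hl2 c1 c2 hs
    have a2 := mix_cd_metric hinf hS (Quotient.out ρ').2 (Quotient.out ρ).2 hl2 hl1 c2 c1 hs
    have b1 := hpar s hs t ht
    have b2 := hpar t ht s hs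
    rw [abs_sub_comm t s] at b2
    have f1 : 0 < 1 + |s - t| * C := by positivity
    have f2 : 1 + |s - t| * C ≤ Real.exp (η * C) := by
      have h1 : |s - t| * C ≤ η * C := mul_le_mul_of_nonneg_right hst.le hC
      linarith [Real.add_one_le_exp (η * C)]
    rw [hH ρ t ht, hH ρ' s hs]
    refine delta_lt hinf _ _ (l1 := l1 * l2 * (1 + |s - t| * C))
      (l2 := (1 + |s - t| * C) * (l2 * l1)) (by positivity) (by positivity)
      (a1.trans (by positivity) b1) (b2.trans f1.le a2) ?_
    have f3 : l1 * l2 * (1 + |s - t| * C) ≤ Real.exp (η + η * C) := by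
      rw [Real.exp_add]
      exact mul_le_mul hl.le f2 f1.le (Real.exp_pos _).le
    have f4 : (1 + |s - t| * C) * (l2 * l1) = l1 * l2 * (1 + |s - t| * C) := by ring
    rw [f4]
    calc _ ≤ Real.exp (η + η * C) * Real.exp (η + η * C) :=
          mul_le_mul f3 f3 (by positivity) (Real.exp_pos _).le
      _ = Real.exp (ε / 2) := by
          rw [← Real.exp_add]
          congr 1
          rw [hη]
          field_simp
          ring
      _ < Real.exp ε := Real.exp_lt_exp.2 (by linarith)

end
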